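/- arXiv:2510.24513 — 2 statements merged into one kernel-verified Lean document; each statement's English description precedes it below -/
import Mathlib

section
/- Let X be a Dacey space and A an orthoclosed subset of X, regarded as an orthoset with the restricted orthogonality relation and falsity 0. Then: (i) A is itself a Dacey space; (ii) if X is atomistic, so is A; (iii) if C(X) has the covering property, so has C(A). -/
class Orthoset (X : Type*) extends Zero X where
  perp : X → X → Prop
  perp_comm : ∀ x y : X, perp x y → perp y x
  perp_self : ∀ x : X, perp x x → x = 0
  zero_perp : ∀ x : X, perp 0 x

namespace Orthoset

variable {X : Type*} [Orthoset X]

/-- The orthocomplement of a subset of an orthoset. -/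
def ortho (A : Set X) : Set X := {x : X | ∀ y ∈ A, perp x y}

/-- A subset is orthoclosed if it equals its double orthocomplement. -/
def Orthoclosed (A : Set X) : Prop := ortho (ortho A) = A

/-- An orthoclosed subset of an orthoset, equipped with the restricted orthogonality
relation and falsity `0`, is again an orthoset. -/
def subOrthoset (A : Set X) (hA : Orthoclosed A) : Orthoset A where
  zero := ⟨0, by
    have h0 : (0 : X) ∈ ortho (ortho A) := fun y _ => zero_perp y
    rw [hA] at h0; exact h0⟩
  perp x y := perp (x : X) (y : X)
  perp_comm x y h := perp_comm _ _ h
  perp_self x h := Subtype.ext (perp_self _ h)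
  zero_perp x := zero_perp _

/-- `X` is a Dacey space: `C(X)` is orthomodular, i.e. for orthoclosed `B ⊆ A` one has
`A = B ∨ (A ∩ B^⊥)`. -/
def IsDacey (X : Type*) [Orthoset X] : Prop :=
  ∀ A B : Set X, Orthoclosed A → Orthoclosed B → B ⊆ A →
    A = ortho (ortho (B ∪ (A ∩ ortho B)))

/-- `X` is atomistic: for proper `x, y`, `{x}^⊥ ⊆ {y}^⊥` implies `{x}^⊥ = {y}^⊥`. -/
def Atomistic (X : Type*) [Orthoset X] : Prop :=
  ∀ x y : X, x ≠ 0 → y ≠ 0 → ortho ({x} : Set X) ⊆ ortho ({y} : Set X) →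
    ortho ({x} : Set X) = ortho ({y} : Set X)

/-- `P` is an atom of the lattice `C(X)` of orthoclosed subsets. -/
def IsAtomC (X : Type*) [Orthoset X] (P : Set X) : Prop :=
  Orthoclosed P ∧ P ≠ {0} ∧
    ∀ Q : Set X, Orthoclosed Q → Q ⊆ P → Q = {0} ∨ Q = P

/-- `B` covers `A` in the lattice `C(X)` of orthoclosed subsets. -/
def CoversC {X : Type*} [Orthoset X] (A B : Set X) : Prop :=
  A ⊂ B ∧ ∀ C : Set X, Orthoclosed C → A ⊆ C → C ⊆ B → C = A ∨ C = B

/-- The lattice `C(X)` has the covering property: for any orthoclosed `A` and any atom `P`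
with `P ⊄ A`, the join `A ∨ P` covers `A`. -/
def CoveringProperty (X : Type*) [Orthoset X] : Prop :=
  ∀ A P : Set X, Orthoclosed A → IsAtomC X P → ¬ P ⊆ A →
    CoversC A (ortho (ortho (A ∪ P)))

end Orthoset

namespace Orthoset

theorem ortho_anti {X : Type*} [Orthoset X] {S T : Set X} (h : S ⊆ T) : ortho T ⊆ ortho S :=
  fun _ hx y hy => hx y (h hy)

theorem sub_oo {X : Type*} [Orthoset X] (S : Set X) : S ⊆ ortho (ortho S) :=
  fun _ hx _ hy => perp_comm _ _ (hy _ hx)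

theorem ooo {X : Type*} [Orthoset X] (S : Set X) : ortho (ortho (ortho S)) = ortho S :=
  Set.Subset.antisymm (ortho_anti (sub_oo S)) (sub_oo _)

theorem ortho_union {X : Type*} [Orthoset X] (S T : Set X) :
    ortho (S ∪ T) = ortho S ∩ ortho T := by
  ext x
  constructor
  · intro h
    exact ⟨fun y hy => h y (Or.inl hy), fun y hy => h y (Or.inr hy)⟩
  · rintro ⟨h1, h2⟩ y (hy | hy)
    · exact h1 y hy
    · exact h2 y hy

theorem key {X : Type*} [Orthoset X] (hX : IsDacey X) (A : Set X) (hA : Orthoclosed A)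
    (S : Set X) (hS : S ⊆ A) : ortho (ortho S ∩ A) ∩ A = ortho (ortho S) := by
  have h := hX (ortho S) (ortho A) (ooo S) (ooo A) (ortho_anti hS)
  have h2 := congrArg ortho h
  rw [ooo, ortho_union] at h2
  unfold Orthoclosed at hA
  rw [hA] at h2
  rw [h2, Set.inter_comm]

theorem image_ortho {X : Type*} [Orthoset X] (A : Set X) (hA : Orthoclosed A) (S : Set A) :
    letI : Orthoset A := subOrthoset A hA
    Subtype.val '' (ortho S) = ortho (Subtype.val '' S) ∩ A := by
  letI : Orthoset A := subOrthoset A hA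
  ext x
  constructor
  · rintro ⟨a, ha, rfl⟩
    refine ⟨?_, a.2⟩
    rintro _ ⟨b, hb, rfl⟩
    exact ha b hb
  · rintro ⟨h, hx⟩
    exact ⟨⟨x, hx⟩, fun b hb => h b ⟨b, hb, rfl⟩, rfl⟩

theorem image_oo {X : Type*} [Orthoset X] (hX : IsDacey X) (A : Set X) (hA : Orthoclosed A)
    (S : Set A) :
    letI : Orthoset A := subOrthoset A hA
    Subtype.val '' (ortho (ortho S)) = ortho (ortho (Subtype.val '' S)) := by
  rw [image_ortho, image_ortho, key hX A hA _ (Subtype.coe_image_subset A S)]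

theorem closed_iff {X : Type*} [Orthoset X] (hX : IsDacey X) (A : Set X) (hA : Orthoclosed A)
    (S : Set A) :
    letI : Orthoset A := subOrthoset A hA
    Orthoclosed S ↔ Orthoclosed (Subtype.val '' S) := by
  unfold Orthoclosed
  rw [← image_oo hX A hA, (Subtype.val_injective.image_injective).eq_iff]

theorem image_zero {X : Type*} [Orthoset X] (A : Set X) (hA : Orthoclosed A) :
    letI : Orthoset A := subOrthoset A hA
    Subtype.val '' ({0} : Set A) = ({0} : Set X) := by
  rw [Set.image_singleton]
  rfl

end Orthoset

open Orthoset

/-- Let `A` be an orthoclosed subset of a Dacey space `X`, regarded as an orthoset with the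
restricted orthogonality relation and falsity `0`. Then (i) `A` is a Dacey space;
(ii) if `X` is atomistic, so is `A`; (iii) if `C(X)` has the covering property, so has `C(A)`. -/
theorem stmt2 {X : Type*} [Orthoset X] (hX : IsDacey X)
    (A : Set X) (hA : Orthoclosed A) :
    letI : Orthoset A := subOrthoset A hA
    IsDacey A ∧ (Atomistic X → Atomistic A) ∧
      (CoveringProperty X → CoveringProperty A) := by
  have inj : Function.Injective (Set.image (Subtype.val : A → X)) :=
    Subtype.val_injective.image_injective
  refine ⟨?_, ?_, ?_⟩
  · intro C B hC hB hBC
    have hC' := (closed_iff hX A hA C).1 hC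
    have hB' := (closed_iff hX A hA B).1 hB
    apply inj
    rw [image_oo hX A hA, Set.image_union, Set.image_inter Subtype.val_injective,
      image_ortho A hA, Set.inter_comm (ortho _) A, ← Set.inter_assoc,
      Set.inter_eq_left.2 (Subtype.coe_image_subset A C)]
    exact hX _ _ hC' hB' (Set.image_mono hBC)
  · intro h x y hx hy hxy
    have hx' : (x : X) ≠ 0 := fun e => hx (Subtype.ext e)
    have hy' : (y : X) ≠ 0 := fun e => hy (Subtype.ext e)
    have h1 := Set.image_mono (f := (Subtype.val : A → X)) (@ortho_anti A (subOrthoset A hA) _ _ hxy)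
    rw [image_oo hX A hA, image_oo hX A hA, Set.image_singleton, Set.image_singleton] at h1
    have h2 := ortho_anti h1
    rw [ooo, ooo] at h2
    have h3 := h x y hx' hy' h2
    apply inj
    rw [image_ortho A hA, image_ortho A hA, Set.image_singleton, Set.image_singleton, h3]
  · intro h B P hB hP hPB
    have lift : ∀ Q : Set X, Orthoclosed Q → Q ⊆ A →
        ∃ R : Set A, @Orthoclosed A (subOrthoset A hA) R ∧ Subtype.val '' R = Q := by
      intro Q hQ hQA
      have e : Subtype.val '' ((Subtype.val : A → X) ⁻¹' Q) = Q := by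
        rw [Subtype.image_preimage_coe, Set.inter_eq_right.2 hQA]
      exact ⟨_, (closed_iff hX A hA _).2 (e.symm ▸ hQ), e⟩
    have hP' : IsAtomC X (Subtype.val '' P) := by
      refine ⟨(closed_iff hX A hA P).1 hP.1, ?_, ?_⟩
      · rw [← image_zero A hA]
        exact fun e => hP.2.1 (inj e)
      · intro Q hQ hQP
        obtain ⟨R, hR, rfl⟩ := lift Q hQ (hQP.trans (Subtype.coe_image_subset A P))
        rw [Set.image_subset_image_iff Subtype.val_injective] at hQP
        rcases hP.2.2 R hR hQP with e | e
        · left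
          rw [e]
          exact image_zero A hA
        · right
          rw [e]
    have hc := h (Subtype.val '' B) (Subtype.val '' P) ((closed_iff hX A hA B).1 hB) hP'
      (by rwa [Set.image_subset_image_iff Subtype.val_injective])
    rw [← Set.image_union, ← image_oo hX A hA] at hc
    refine ⟨⟨?_, ?_⟩, ?_⟩
    · exact (Set.image_subset_image_iff Subtype.val_injective).1 hc.1.1
    · exact fun e => hc.1.2 (Set.image_mono e)
    · intro C hC h1 h2
      rcases hc.2 _ ((closed_iff hX A hA C).1 hC) (Set.image_mono h1) (Set.image_mono h2) with e | e
      · exact Or.inl (inj e)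
      · exact Or.inr (inj e)
end

section
/- Let X be an orthoset and assume that for every orthoclosed subset A of X the inclusion map A → X is adjointable, i.e., there exists a map σ : X → A such that for all a ∈ A and x ∈ X, a ⊥ x iff a ⊥ σ(x). Then X is a Dacey space (C(X) is orthomodular). If moreover X is atomistic, then C(X) is an atomistic lattice with the covering property. -/
namespace Orthoset

variable {X : Type*} [Orthoset X]

/-- The lattice `C(X)` is atomistic: every orthoclosed set is the join of the atoms
below it. -/
def LatticeAtomistic (X : Type*) [Orthoset X] : Prop :=
  ∀ A : Set X, Orthoclosed A →
    A = ortho (ortho (⋃₀ {P : Set X | IsAtomC X P ∧ P ⊆ A}))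

end Orthoset

open Orthoset

namespace Orthoset

variable {X : Type*} [Orthoset X]

lemma aux_symm {x y : X} (h : perp x y) : perp y x := perp_comm x y h

lemma aux_anti {A B : Set X} (h : A ⊆ B) : ortho B ⊆ ortho A :=
  fun _ hx y hy => hx y (h hy)

lemma aux_sub (A : Set X) : A ⊆ ortho (ortho A) :=
  fun x hx _ hy => aux_symm (hy x hx)

lemma aux_closed (A : Set X) : Orthoclosed (ortho A) :=
  Set.Subset.antisymm (aux_anti (aux_sub A)) (aux_sub (ortho A))

lemma aux_zero (A : Set X) : (0 : X) ∈ ortho A := fun y _ => zero_perp y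

lemma aux_zero_mem {A : Set X} (h : Orthoclosed A) : (0 : X) ∈ A := by
  rw [← h]; exact aux_zero _

lemma aux_hull {A C : Set X} (hC : Orthoclosed C) (h : A ⊆ C) : ortho (ortho A) ⊆ C := by
  intro x hx
  rw [← hC]
  exact aux_anti (aux_anti h) hx

lemma aux_exists {A : Set X} (h : Orthoclosed A) (hne : A ≠ {0}) : ∃ q ∈ A, q ≠ 0 := by
  by_contra hcon
  push Not at hcon
  apply hne
  ext x
  constructor
  · intro hx; exact hcon x hx
  · intro hx
    rw [Set.mem_singleton_iff] at hx
    rw [hx]; exact aux_zero_mem h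

lemma aux_atom (hX : Atomistic X) {x : X} (hx : x ≠ 0) :
    IsAtomC X (ortho (ortho ({x} : Set X))) := by
  refine ⟨aux_closed _, ?_, ?_⟩
  · intro h
    have : x ∈ ortho (ortho ({x} : Set X)) := aux_sub _ rfl
    rw [h] at this
    exact hx this
  · intro Q hQ hsub
    by_cases hne : Q = {0}
    · exact Or.inl hne
    right
    obtain ⟨q, hq, hq0⟩ := aux_exists hQ hne
    have h1 : ortho ({x} : Set X) ⊆ ortho ({q} : Set X) := by
      intro y hy z hz
      rw [Set.mem_singleton_iff] at hz
      rw [hz]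
      exact aux_symm (hsub hq y hy)
    have h2 := hX x q hx hq0 h1
    apply Set.Subset.antisymm hsub
    rw [h2]
    exact aux_hull hQ (Set.singleton_subset_iff.mpr hq)

lemma aux_dacey (hadj : ∀ A : Set X, Orthoclosed A →
      ∃ σ : X → X, (∀ x : X, σ x ∈ A) ∧
        ∀ a ∈ A, ∀ x : X, (Orthoset.perp a x ↔ Orthoset.perp a (σ x))) : IsDacey X := by
  intro A B hA hB hBA
  apply Set.Subset.antisymm
  · intro x hx y hy
    obtain ⟨σ, h1, h2⟩ := hadj A hA
    have h3 : σ y ∈ ortho B := fun b hb =>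
      aux_symm ((h2 b (hBA hb) y).1 (aux_symm (hy b (Or.inl hb))))
    have h4 : perp y (σ y) := hy _ (Or.inr ⟨h1 y, h3⟩)
    have h5 : σ y = 0 := perp_self _ ((h2 _ (h1 y) y).1 (aux_symm h4))
    apply (h2 x hx y).2
    rw [h5]
    exact aux_symm (zero_perp x)
  · exact aux_hull hA (Set.union_subset hBA Set.inter_subset_left)

lemma aux_lattice (hX : Atomistic X) : LatticeAtomistic X := by
  intro A hA
  apply Set.Subset.antisymm
  · intro x hx
    by_cases h0 : x = 0
    · rw [h0]; exact aux_zero _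
    · exact aux_sub _ ⟨_, ⟨aux_atom hX h0, aux_hull hA (Set.singleton_subset_iff.mpr hx)⟩,
        aux_sub _ rfl⟩
  · exact aux_hull hA (Set.sUnion_subset fun P hP => hP.2)

lemma aux_covering (hadj : ∀ A : Set X, Orthoclosed A →
      ∃ σ : X → X, (∀ x : X, σ x ∈ A) ∧
        ∀ a ∈ A, ∀ x : X, (Orthoset.perp a x ↔ Orthoset.perp a (σ x)))
    (hX : Atomistic X) : CoveringProperty X := by
  intro A P hA hP hPA
  obtain ⟨p, hpP, hpA⟩ := Set.not_subset.mp hPA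
  have hp0 : p ≠ 0 := fun h => hpA (h ▸ aux_zero_mem hA)
  have hPp : ortho (ortho ({p} : Set X)) = P := by
    rcases hP.2.2 _ (aux_closed _) (aux_hull hP.1 (Set.singleton_subset_iff.mpr hpP)) with h | h
    · exact absurd h (aux_atom hX hp0).2.1
    · exact h
  have hAJ : A ⊆ ortho (ortho (A ∪ P)) := fun x hx => aux_sub _ (Or.inl hx)
  refine ⟨⟨hAJ, fun h => hpA (h (aux_sub _ (Or.inr hpP)))⟩, ?_⟩
  intro C hC hAC hCJ
  by_cases hCA : C = A
  · exact Or.inl hCA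
  right
  apply Set.Subset.antisymm hCJ
  have hdac := aux_dacey hadj C A hC hA hAC
  obtain ⟨q, hqC, hqA, hq0⟩ : ∃ q ∈ C, q ∈ ortho A ∧ q ≠ 0 := by
    by_contra hcon
    push Not at hcon
    apply hCA
    refine Set.Subset.antisymm ?_ hAC
    rw [hdac]
    apply aux_hull hA
    rintro x (hx | ⟨hx, hx'⟩)
    · exact hx
    · rw [hcon x hx hx']; exact aux_zero_mem hA
  obtain ⟨σ, h1, h2⟩ := hadj (ortho A) (aux_closed A)
  have hσ0 : σ p ≠ 0 := by
    intro h
    apply hpA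
    rw [← hA]
    intro y hy
    apply aux_symm
    apply (h2 y hy p).2
    rw [h]
    exact aux_symm (zero_perp y)
  have hsub : ortho ({σ p} : Set X) ⊆ ortho ({q} : Set X) := by
    intro y hy z hz
    rw [Set.mem_singleton_iff] at hz
    rw [hz]
    have hy1 : perp (σ p) (σ y) := (h2 _ (h1 p) y).1 (aux_symm (hy _ rfl))
    have hy2 : perp (σ y) p := (h2 _ (h1 y) p).2 (aux_symm hy1)
    have hy3 : σ y ∈ ortho (A ∪ P) := by
      rintro w (hw | hw)
      · exact h1 y w hw
      · rw [← hPp] at hw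
        refine aux_symm (hw _ ?_)
        intro v hv
        rw [Set.mem_singleton_iff] at hv
        rw [hv]; exact hy2
    exact aux_symm ((h2 q hqA y).2 (hCJ hqC _ hy3))
  have heq := hX _ _ hσ0 hq0 hsub
  have hσC : σ p ∈ C := by
    apply aux_hull hC (Set.singleton_subset_iff.mpr hqC)
    rw [← heq]
    exact aux_sub _ rfl
  have hpC : p ∈ C := by
    rw [← hC]
    intro y hy
    exact aux_symm ((h2 y (aux_anti hAC hy) p).2 (hy _ hσC))
  apply aux_hull hC
  apply Set.union_subset hAC
  rw [← hPp]
  exact aux_hull hC (Set.singleton_subset_iff.mpr hpC)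

end Orthoset

/-- Assume that for every orthoclosed subset `A` of the orthoset `X` the inclusion map
`A → X` is adjointable, i.e. there is `σ : X → X` with values in `A` such that for all
`a ∈ A` and `x ∈ X`, `a ⊥ x` iff `a ⊥ σ x`. Then `X` is a Dacey space, and if `X` is
moreover atomistic, then `C(X)` is an atomistic lattice with the covering property. -/
theorem stmt14 {X : Type*} [Orthoset X]
    (hadj : ∀ A : Set X, Orthoclosed A →
      ∃ σ : X → X, (∀ x : X, σ x ∈ A) ∧
        ∀ a ∈ A, ∀ x : X, (Orthoset.perp a x ↔ Orthoset.perp a (σ x))) :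
    IsDacey X ∧
      (Atomistic X → LatticeAtomistic X ∧ CoveringProperty X) := by
  exact ⟨aux_dacey hadj, fun hX => ⟨aux_lattice hX, aux_covering hadj hX⟩⟩
end
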